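/- arXiv:2411.00235 — 2 statements merged into one kernel-verified Lean document; each statement's English description precedes it below -/
import Mathlib

section
/- Fix n ≥ 1 and σ > 0, and let Λ = {Mm : m ∈ ℤ^{2n}} be a full-rank lattice in ℝ^{2n} with invertible generator matrix M, with weights w(ξ) = exp(−σ²‖ξ‖²/2) and lattice-Gaussian probability density p_σ(x; Λ) = N⁻¹ Σ_{ξ∈Λ} w(ξ)·exp(−‖x−ξ‖²/(2σ²)), N = (2πσ²)^n · Σ_{ξ∈Λ} w(ξ). Let f : ℝ^{2n} → ℝ be Lipschitz with Lipschitz constant l. Then |∫_{ℝ^{2n}} p_σ(x; Λ)·f(x) dx − (Σ_{ξ∈Λ} w(ξ))⁻¹ · Σ_{ξ∈Λ} w(ξ)·f(ξ)| ≤ 2·σ·l·Γ(n+1/2)/Γ(n). -/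
open MeasureTheory Real

/-- The lattice point `M·m ∈ ℝ^{2n}` (as an element of Euclidean space) associated to an
integer vector `m ∈ ℤ^{2n}` and a generator matrix `M`. -/
noncomputable def latticePt (n : ℕ) (M : Matrix (Fin (2 * n)) (Fin (2 * n)) ℝ)
    (m : Fin (2 * n) → ℤ) : EuclideanSpace ℝ (Fin (2 * n)) :=
  (EuclideanSpace.equiv (Fin (2 * n)) ℝ).symm (M.mulVec fun i => (m i : ℝ))

section GaussianMoments

variable {E : Type*} [NormedAddCommGroup E] [InnerProductSpace ℝ E] [FiniteDimensional ℝ E]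

theorem summable_norm_pow_mul_exp_neg_mul_sq (L : Submodule ℤ E) [DiscreteTopology L] {a : ℝ}
    (ha : 0 < a) (j : ℕ) : Summable fun z : L ↦ ‖z‖ ^ j * exp (-(a * ‖z‖ ^ 2)) := by
  obtain ⟨N, hN⟩ : ∃ N, N = Module.finrank ℤ L + j + 1 := ⟨_, rfl⟩
  have hs := (ZLattice.summable_norm_pow_inv L (2 * N - j) (by omega)).mul_left (N.factorial / a ^ N)
  refine hs.of_norm_bounded_eventually ?_
  refine (Set.finite_singleton (0 : L)).subset fun z hz ↦ ?_
  by_contra hz0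
  refine hz ?_
  rw [Set.mem_ofPred_eq]
  have hr : 0 < ‖z‖ := norm_pos_iff.2 hz0
  have hexp := pow_div_factorial_le_exp (a * ‖z‖ ^ 2) (by positivity) N
  have hpow : ‖z‖ ^ (2 * N) = ‖z‖ ^ j * ‖z‖ ^ (2 * N - j) := by
    rw [← pow_add]; congr 1; omega
  rw [norm_of_nonneg (by positivity), exp_neg]
  calc ‖z‖ ^ j * (exp (a * ‖z‖ ^ 2))⁻¹
      ≤ ‖z‖ ^ j * ((a * ‖z‖ ^ 2) ^ N / N.factorial)⁻¹ := by gcongr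
    _ = _ := by
      rw [mul_pow, ← pow_mul, hpow, inv_pow]
      field_simp

variable [MeasurableSpace E] [BorelSpace E]

theorem integrable_exp_neg_mul_sq_norm {b : ℝ} (hb : 0 < b) :
    Integrable fun x : E ↦ exp (-b * ‖x‖ ^ 2) := by
  have h := GaussianFourier.integrable_cexp_neg_mul_sq_norm_add (V := E)
    (show 0 < (b : ℂ).re from hb) 0 0
  refine h.norm.congr (ae_of_all _ fun x ↦ ?_)
  simp [Complex.norm_exp, ← Complex.ofReal_pow]

theorem integrable_norm_mul_exp_neg_mul_sq_norm {b : ℝ} (hb : 0 < b) :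
    Integrable fun x : E ↦ ‖x‖ * exp (-b * ‖x‖ ^ 2) := by
  have h2 : 0 < b / 2 := by positivity
  refine ((integrable_exp_neg_mul_sq_norm (E := E) h2).const_mul (1 + 1 / (2 * b))).mono'
    (by fun_prop) (ae_of_all _ fun x ↦ ?_)
  rw [norm_of_nonneg (by positivity)]
  have h1 : ‖x‖ ≤ (1 + 1 / (2 * b)) * exp (b / 2 * ‖x‖ ^ 2) := by
    have h3 := add_one_le_exp (b / 2 * ‖x‖ ^ 2)
    have h4 : ‖x‖ ≤ (1 + 1 / (2 * b)) * (b / 2 * ‖x‖ ^ 2 + 1) := by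
      have : (1 + 1 / (2 * b)) * (b / 2 * ‖x‖ ^ 2 + 1) - ‖x‖
          = b / 2 * ‖x‖ ^ 2 + 1 / (2 * b) + (‖x‖ / 2 - 1) ^ 2 := by
        field_simp; ring
      have : 0 ≤ b / 2 * ‖x‖ ^ 2 + 1 / (2 * b) + (‖x‖ / 2 - 1) ^ 2 := by positivity
      linarith
    exact h4.trans (by gcongr)
  calc ‖x‖ * exp (-b * ‖x‖ ^ 2)
      ≤ ((1 + 1 / (2 * b)) * exp (b / 2 * ‖x‖ ^ 2)) * exp (-b * ‖x‖ ^ 2) := by gcongr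
    _ = _ := by
      rw [mul_assoc, ← exp_add]
      ring_nf

theorem integral_norm_mul_exp_neg_mul_sq_norm [Nontrivial E] {b : ℝ} (hb : 0 < b) :
    ∫ x : E, ‖x‖ * exp (-b * ‖x‖ ^ 2) =
      (∫ x : E, exp (-b * ‖x‖ ^ 2)) * (b ^ (-(1 / 2) : ℝ) *
        Gamma ((Module.finrank ℝ E + 1) / 2) / Gamma (Module.finrank ℝ E / 2)) := by
  have hd : 0 < Module.finrank ℝ E := Module.finrank_pos
  have hd' : (0 : ℝ) < Module.finrank ℝ E := by exact_mod_cast hd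
  have hcast : ((Module.finrank ℝ E - 1 : ℕ) : ℝ) = Module.finrank ℝ E - 1 := by
    rw [Nat.cast_sub hd, Nat.cast_one]
  have h0 := integral_rpow_mul_exp_neg_mul_rpow (p := 2) (q := Module.finrank ℝ E - 1) two_pos
    (by linarith) hb
  have h1 := integral_rpow_mul_exp_neg_mul_rpow (p := 2) (q := Module.finrank ℝ E) two_pos
    (by linarith) hb
  rw [integral_fun_norm_addHaar volume (fun r ↦ r * exp (-b * r ^ 2)),
    integral_fun_norm_addHaar volume (fun r ↦ exp (-b * r ^ 2))]
  have e0 : ∫ y in Set.Ioi (0 : ℝ), y ^ (Module.finrank ℝ E - 1) • exp (-b * y ^ 2) =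
      b ^ (-(Module.finrank ℝ E : ℝ) / 2) * (1 / 2) * Gamma (Module.finrank ℝ E / 2) := by
    simp only [sub_add_cancel] at h0
    rw [← h0]
    refine setIntegral_congr_fun measurableSet_Ioi fun y _ ↦ ?_
    simp [← hcast]
  have e1 : ∫ y in Set.Ioi (0 : ℝ), y ^ (Module.finrank ℝ E - 1) • (y * exp (-b * y ^ 2)) =
      b ^ (-(Module.finrank ℝ E + 1 : ℝ) / 2) * (1 / 2) *
        Gamma ((Module.finrank ℝ E + 1) / 2) := by
    rw [← h1]
    refine setIntegral_congr_fun measurableSet_Ioi fun y _ ↦ ?_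
    simp only [smul_eq_mul, rpow_natCast, rpow_ofNat]
    rw [← mul_assoc, ← pow_succ, Nat.sub_add_cancel hd]
  have hG : Gamma (Module.finrank ℝ E / 2 : ℝ) ≠ 0 := (Gamma_pos_of_pos (by positivity)).ne'
  have hsplit : b ^ (-(Module.finrank ℝ E + 1 : ℝ) / 2) =
      b ^ (-(Module.finrank ℝ E : ℝ) / 2) * b ^ (-(1 / 2) : ℝ) := by
    rw [← rpow_add hb]; ring_nf
  rw [e0, e1, hsplit]
  simp only [nsmul_eq_mul, smul_eq_mul]
  field_simp

theorem LipschitzWith.integrable_exp_neg_mul_sq_norm_sub_mul {f : E → ℝ} {l : NNReal}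
    (hf : LipschitzWith l f) {b : ℝ} (hb : 0 < b) (ξ : E) :
    Integrable fun x ↦ exp (-b * ‖x - ξ‖ ^ 2) * f x := by
  have h0 := ((integrable_exp_neg_mul_sq_norm (E := E) hb).comp_sub_right ξ).const_mul |f ξ|
  have h1 := ((integrable_norm_mul_exp_neg_mul_sq_norm (E := E) hb).comp_sub_right ξ).const_mul
    (l : ℝ)
  have hfc := hf.continuous
  refine (h0.add h1).mono' (by fun_prop) (ae_of_all _ fun x ↦ ?_)
  have hx := hf.dist_le_mul x ξ
  rw [Real.dist_eq, dist_eq_norm] at hx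
  have hfx : |f x| ≤ |f ξ| + l * ‖x - ξ‖ := by
    have := abs_sub_abs_le_abs_sub (f x) (f ξ)
    linarith
  rw [norm_mul, norm_of_nonneg (exp_pos _).le, norm_eq_abs]
  calc exp (-b * ‖x - ξ‖ ^ 2) * |f x|
      ≤ exp (-b * ‖x - ξ‖ ^ 2) * (|f ξ| + l * ‖x - ξ‖) := by gcongr
    _ = _ := by simp only [Pi.add_apply]; ring

theorem LipschitzWith.abs_integral_exp_neg_mul_sq_norm_sub_mul_sub_le {f : E → ℝ} {l : NNReal}
    (hf : LipschitzWith l f) {b : ℝ} (hb : 0 < b) (ξ : E) :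
    |(∫ x, exp (-b * ‖x - ξ‖ ^ 2) * f x) - (∫ x : E, exp (-b * ‖x‖ ^ 2)) * f ξ| ≤
      l * ∫ x : E, ‖x‖ * exp (-b * ‖x‖ ^ 2) := by
  have h0 := (integrable_exp_neg_mul_sq_norm (E := E) hb).comp_sub_right ξ
  have h1 := (integrable_norm_mul_exp_neg_mul_sq_norm (E := E) hb).comp_sub_right ξ
  rw [← integral_sub_right_eq_self (fun x : E ↦ exp (-b * ‖x‖ ^ 2)) ξ,
    ← integral_sub_right_eq_self (fun x : E ↦ ‖x‖ * exp (-b * ‖x‖ ^ 2)) ξ,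
    ← integral_mul_const, ← integral_const_mul,
    ← integral_sub (hf.integrable_exp_neg_mul_sq_norm_sub_mul hb ξ) (h0.mul_const _),
    ← norm_eq_abs]
  refine norm_integral_le_of_norm_le (h1.const_mul _) (ae_of_all _ fun x ↦ ?_)
  have hx := hf.dist_le_mul x ξ
  rw [Real.dist_eq, dist_eq_norm] at hx
  rw [← mul_sub, norm_mul, norm_of_nonneg (exp_pos _).le, norm_eq_abs]
  calc exp (-b * ‖x - ξ‖ ^ 2) * |f x - f ξ|
      ≤ exp (-b * ‖x - ξ‖ ^ 2) * (l * ‖x - ξ‖) := by gcongr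
    _ = _ := by ring

/-- Replacing each point mass of a weighted sum by a Gaussian bump changes the sum of the values of
a Lipschitz function by at most the total weight times the first absolute moment of the bump. -/
theorem LipschitzWith.abs_integral_tsum_mul_sub_le {ι : Type*} [Countable ι] {f : E → ℝ}
    {l : NNReal} (hf : LipschitzWith l f) {b : ℝ} (hb : 0 < b) {w : ι → ℝ} {ξ : ι → E}
    (hw0 : ∀ i, 0 ≤ w i) (hw : Summable w) (hwξ : Summable fun i ↦ w i * ‖ξ i‖) :
    |(∫ x, (∑' i, w i * exp (-b * ‖x - ξ i‖ ^ 2)) * f x) -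
        (∫ x : E, exp (-b * ‖x‖ ^ 2)) * ∑' i, w i * f (ξ i)| ≤
      (∑' i, w i) * (l * ∫ x : E, ‖x‖ * exp (-b * ‖x‖ ^ 2)) := by
  set G := ∫ x : E, exp (-b * ‖x‖ ^ 2)
  set G₁ := ∫ x : E, ‖x‖ * exp (-b * ‖x‖ ^ 2)
  have hwf : Summable fun i ↦ w i * |f (ξ i)| := by
    refine ((hw.mul_left |f 0|).add (hwξ.mul_left (l : ℝ))).of_nonneg_of_le
      (fun i ↦ mul_nonneg (hw0 i) (abs_nonneg _)) fun i ↦ ?_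
    have hx := hf.dist_le_mul (ξ i) 0
    rw [Real.dist_eq, dist_eq_norm, sub_zero] at hx
    have := abs_sub_abs_le_abs_sub (f (ξ i)) (f 0)
    have hle : |f (ξ i)| ≤ |f 0| + l * ‖ξ i‖ := by linarith
    calc w i * |f (ξ i)| ≤ w i * (|f 0| + l * ‖ξ i‖) := mul_le_mul_of_nonneg_left hle (hw0 i)
      _ = _ := by ring
  have hint i := (hf.integrable_exp_neg_mul_sq_norm_sub_mul hb (ξ i)).const_mul (w i)
  have habs : LipschitzWith l fun x ↦ |f x| := by
    simpa [Function.comp_def] using lipschitzWith_one_norm.comp hf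
  have hnorm : Summable fun i ↦ ∫ x, ‖w i * (exp (-b * ‖x - ξ i‖ ^ 2) * f x)‖ := by
    refine ((hwf.mul_left G).add (hw.mul_right (l * G₁))).of_nonneg_of_le
      (fun i ↦ integral_nonneg fun x ↦ norm_nonneg _) fun i ↦ ?_
    have h := (abs_le.1 (habs.abs_integral_exp_neg_mul_sq_norm_sub_mul_sub_le hb (ξ i))).2
    have hle : ∫ x, exp (-b * ‖x - ξ i‖ ^ 2) * |f x| ≤ G * |f (ξ i)| + l * G₁ := by linarith
    calc ∫ x, ‖w i * (exp (-b * ‖x - ξ i‖ ^ 2) * f x)‖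
        = w i * ∫ x, exp (-b * ‖x - ξ i‖ ^ 2) * |f x| := by
          simp_rw [norm_mul, norm_of_nonneg (hw0 i), norm_of_nonneg (exp_pos _).le, norm_eq_abs]
          rw [integral_const_mul]
      _ ≤ w i * (G * |f (ξ i)| + l * G₁) := mul_le_mul_of_nonneg_left hle (hw0 i)
      _ = _ := by ring
  have hsum := hasSum_integral_of_summable_integral_norm hint hnorm
  simp_rw [← mul_assoc, tsum_mul_right, mul_assoc, integral_const_mul] at hsum
  have hwf' : Summable fun i ↦ w i * f (ξ i) :=
    hwf.of_norm_bounded fun i ↦ by rw [norm_mul, norm_of_nonneg (hw0 i), norm_eq_abs]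
  rw [← hsum.tsum_eq, ← tsum_mul_left, ← hsum.summable.tsum_sub (hwf'.mul_left G), ← tsum_mul_right,
    ← norm_eq_abs]
  refine tsum_of_norm_bounded (hw.mul_right _).hasSum fun i ↦ ?_
  have h := hf.abs_integral_exp_neg_mul_sq_norm_sub_mul_sub_le hb (ξ i)
  rw [show ∀ I : ℝ, w i * I - G * (w i * f (ξ i)) = w i * (I - G * f (ξ i)) by intro I; ring,
    norm_mul, norm_of_nonneg (hw0 i), norm_eq_abs]
  exact mul_le_mul_of_nonneg_left h (hw0 i)

end GaussianMoments

theorem summable_latticePt_norm_pow_mul_exp (n : ℕ) (M : Matrix (Fin (2 * n)) (Fin (2 * n)) ℝ)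
    (hM : IsUnit M.det) {a : ℝ} (ha : 0 < a) (j : ℕ) :
    Summable fun m : Fin (2 * n) → ℤ ↦
      ‖latticePt n M m‖ ^ j * exp (-(a * ‖latticePt n M m‖ ^ 2)) := by
  obtain ⟨e, he⟩ : ∃ e : (Fin (2 * n) → ℝ) ≃ₗ[ℝ] EuclideanSpace ℝ (Fin (2 * n)),
      ∀ m : Fin (2 * n) → ℤ, latticePt n M m = e fun i ↦ (m i : ℝ) :=
    ⟨(Matrix.toLinearEquiv' M ((Matrix.isUnit_iff_isUnit_det M).2 hM).invertible).trans
      (EuclideanSpace.equiv (Fin (2 * n)) ℝ).symm.toLinearEquiv, fun _ ↦ rfl⟩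
  have hmem (m : Fin (2 * n) → ℤ) : latticePt n M m ∈
      Submodule.span ℤ (Set.range ((Pi.basisFun ℝ (Fin (2 * n))).map e)) := by
    rw [Module.Basis.mem_span_iff_repr_mem, he]
    intro i
    simp
  have hinj : Function.Injective fun m ↦ (⟨latticePt n M m, hmem m⟩ :
      Submodule.span ℤ (Set.range ((Pi.basisFun ℝ (Fin (2 * n))).map e))) := by
    intro m m' h
    have h' := congrArg Subtype.val h
    simp only [he] at h'
    funext i
    exact_mod_cast congrFun (e.injective h') i
  have h := (summable_norm_pow_mul_exp_neg_mul_sq _ ha j).comp_injective hinj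
  simpa only [Function.comp_def, Submodule.coe_norm] using h

/-- Fix `n ≥ 1`, `σ > 0`, a full-rank lattice `Λ = {Mm : m ∈ ℤ^{2n}} ⊂ ℝ^{2n}` with
invertible generator matrix `M`, weights `w(ξ) = exp(−σ²‖ξ‖²/2)` and lattice-Gaussian
probability density `p_σ(x;Λ) = N⁻¹ Σ_{ξ∈Λ} w(ξ)·exp(−‖x−ξ‖²/(2σ²))`,
`N = (2πσ²)ⁿ · Σ_{ξ∈Λ} w(ξ)`. If `f : ℝ^{2n} → ℝ` is Lipschitz with constant `l`, then
`|∫ p_σ(x;Λ)·f(x) dx − (Σ_{ξ∈Λ} w(ξ))⁻¹ · Σ_{ξ∈Λ} w(ξ)·f(ξ)| ≤ 2·σ·l·Γ(n+1/2)/Γ(n)`. -/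
theorem lattice_gaussian_average_lipschitz_error (n : ℕ) (hn : 1 ≤ n) (σ : ℝ)
    (hσ : 0 < σ) (M : Matrix (Fin (2 * n)) (Fin (2 * n)) ℝ) (hM : IsUnit M.det)
    (f : EuclideanSpace ℝ (Fin (2 * n)) → ℝ) (l : NNReal) (hf : LipschitzWith l f)
    (w : (Fin (2 * n) → ℤ) → ℝ)
    (hw : ∀ m, w m = Real.exp (-(σ ^ 2 * ‖latticePt n M m‖ ^ 2) / 2))
    (W N : ℝ) (hW : W = ∑' m : Fin (2 * n) → ℤ, w m)
    (hN : N = (2 * π * σ ^ 2) ^ n * W)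
    (p : EuclideanSpace ℝ (Fin (2 * n)) → ℝ)
    (hp : ∀ x, p x = N⁻¹ *
      ∑' m : Fin (2 * n) → ℤ, w m * Real.exp (-‖x - latticePt n M m‖ ^ 2 / (2 * σ ^ 2))) :
    |(∫ x : EuclideanSpace ℝ (Fin (2 * n)), p x * f x)
        - W⁻¹ * ∑' m : Fin (2 * n) → ℤ, w m * f (latticePt n M m)|
      ≤ 2 * σ * (l : ℝ) * Real.Gamma ((n : ℝ) + 1 / 2) / Real.Gamma (n : ℝ) := by
  have : Nonempty (Fin (2 * n)) := ⟨⟨0, by omega⟩⟩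
  have hn' : (0 : ℝ) < n := by exact_mod_cast hn
  have hw0 m : 0 < w m := by rw [hw]; positivity
  have hw' m : w m = exp (-(σ ^ 2 / 2 * ‖latticePt n M m‖ ^ 2)) := by rw [hw]; ring_nf
  have hsw : Summable w := by
    refine (summable_latticePt_norm_pow_mul_exp n M hM (a := σ ^ 2 / 2) (by positivity) 0).congr
      fun m ↦ ?_
    rw [hw', pow_zero, one_mul]
  have hswξ : Summable fun m ↦ w m * ‖latticePt n M m‖ := by
    refine (summable_latticePt_norm_pow_mul_exp n M hM (a := σ ^ 2 / 2) (by positivity) 1).congr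
      fun m ↦ ?_
    rw [hw', pow_one, mul_comm]
  have hWpos : 0 < W := hW ▸ hsw.tsum_pos (fun m ↦ (hw0 m).le) 0 (hw0 0)
  obtain ⟨b, hb⟩ : ∃ b, b = (2 * σ ^ 2)⁻¹ := ⟨_, rfl⟩
  have hbpos : 0 < b := by rw [hb]; positivity
  have hG : ∫ x : EuclideanSpace ℝ (Fin (2 * n)), exp (-b * ‖x‖ ^ 2) = (2 * π * σ ^ 2) ^ n := by
    rw [GaussianFourier.integral_rexp_neg_mul_sq_norm hbpos, finrank_euclideanSpace_fin,
      Nat.cast_mul, Nat.cast_ofNat, mul_div_cancel_left₀ _ two_ne_zero, rpow_natCast, hb]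
    congr 1
    field_simp
  have hsqrt : b ^ (-(1 / 2) : ℝ) = √2 * σ := by
    rw [hb, rpow_neg (by positivity), ← sqrt_eq_rpow, sqrt_inv, inv_inv, sqrt_mul two_pos.le,
      sqrt_sq hσ.le]
  have hG₁ := integral_norm_mul_exp_neg_mul_sq_norm (E := EuclideanSpace ℝ (Fin (2 * n))) hbpos
  rw [hG, finrank_euclideanSpace_fin, Nat.cast_mul, Nat.cast_ofNat,
    mul_div_cancel_left₀ _ two_ne_zero, add_div, mul_div_cancel_left₀ _ two_ne_zero, hsqrt] at hG₁
  have key := hf.abs_integral_tsum_mul_sub_le hbpos (fun m ↦ (hw0 m).le) hsw hswξ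
  rw [hG₁, hG, ← hW] at key
  have hGpos : (0 : ℝ) < (2 * π * σ ^ 2) ^ n := by positivity
  have hNpos : 0 < N := hN ▸ mul_pos hGpos hWpos
  have hpf : ∫ x, p x * f x =
      N⁻¹ * ∫ x, (∑' m, w m * exp (-b * ‖x - latticePt n M m‖ ^ 2)) * f x := by
    rw [← integral_const_mul]
    refine integral_congr_ae (ae_of_all _ fun x ↦ ?_)
    simp only [hp, mul_assoc]
    congr! 6 with m
    rw [hb]
    field_simp
  rw [hpf, show W⁻¹ = N⁻¹ * (2 * π * σ ^ 2) ^ n by rw [hN]; field_simp, mul_assoc, ← mul_sub,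
    abs_mul, abs_of_pos (inv_pos.2 hNpos)]
  have hsqrt2 : √2 ≤ 2 := by
    rw [sqrt_le_left two_pos.le]; norm_num
  have hΓ : 0 < Gamma (n : ℝ) := Gamma_pos_of_pos hn'
  have hΓ' : 0 < Gamma ((n : ℝ) + 1 / 2) := Gamma_pos_of_pos (by positivity)
  calc _ ≤ N⁻¹ * _ := mul_le_mul_of_nonneg_left key (inv_pos.2 hNpos).le
    _ = √2 * σ * l * Gamma ((n : ℝ) + 1 / 2) / Gamma (n : ℝ) := by
      rw [hN]; field_simp
    _ ≤ _ := by gcongr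
end

section
/- Let M_{A₂} = (1/√(2√3))·[[2,0],[1,√3]] and let Λ = {(1/√2)·mᵀM_{A₂} : m ∈ ℤ²} ⊂ ℝ². For a lattice L ⊂ ℝ², let V(L) = {x ∈ ℝ² : ‖x‖ ≤ ‖x − v‖ for all v ∈ L} be its Voronoi cell around the origin, and define the Voronoi shells V⁰ = V(Λ) and Vᵏ = V((2k+1)·Λ) \ V((2k−1)·Λ) for k ≥ 1. Define p₀ = Σ_{k≥0} ∫_{V^{2k}} exp(−π‖x‖²) dx and p₁ = 1 − p₀. Then p₀ ≤ 0.46; in particular p₀ ≠ 1/2 and |p₀ − p₁| = |2p₀ − 1| ≥ 0.08. -/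
open Matrix MeasureTheory Real

noncomputable section

/-- The generator matrix `M_{A₂} = (1/√(2√3))·[[2,0],[1,√3]]` of the hexagonal lattice
`A₂`, normalized to unit covolume. -/
def MA2 : Matrix (Fin 2) (Fin 2) ℝ :=
  (Real.sqrt (2 * Real.sqrt 3))⁻¹ • !![2, 0; 1, Real.sqrt 3]

/-- The point `(1/√2)·mᵀM_{A₂}` of the scaled hexagonal lattice
`Λ = {(1/√2)·mᵀM_{A₂} : m ∈ ℤ²} ⊂ ℝ²`, as an element of Euclidean space. -/
def hexPt (m : Fin 2 → ℤ) : EuclideanSpace ℝ (Fin 2) :=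
  (EuclideanSpace.equiv (Fin 2) ℝ).symm
    ((Real.sqrt 2)⁻¹ • Matrix.vecMul (fun i => (m i : ℝ)) MA2)

/-- The origin-centred Voronoi cell `V(c·Λ) = {x : ‖x‖ ≤ ‖x − v‖ for all v ∈ c·Λ}` of
the lattice `Λ` rescaled by `c`. -/
def vorCell (c : ℝ) : Set (EuclideanSpace ℝ (Fin 2)) :=
  {x | ∀ m : Fin 2 → ℤ, ‖x‖ ≤ ‖x - c • hexPt m‖}

/-- The Voronoi shells: `V⁰ = V(Λ)` and `Vᵏ = V((2k+1)·Λ) \ V((2k−1)·Λ)` for `k ≥ 1`. -/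
def vorShell : ℕ → Set (EuclideanSpace ℝ (Fin 2))
  | 0 => vorCell 1
  | k + 1 => vorCell (2 * (k + 1 : ℝ) + 1) \ vorCell (2 * (k + 1 : ℝ) - 1)

/-- The probability `p₀ = Σ_{k≥0} ∫_{V^{2k}} exp(−π‖x‖²) dx` that a standard heterodyne
Gaussian displacement falls into an even Voronoi shell of the hexagonal GKP code. -/
def pEven : ℝ := ∑' k : ℕ, ∫ x in vorShell (2 * k), Real.exp (-π * ‖x‖ ^ 2)

/-- The inradius of the Voronoi cell of `Λ`, equal to half its minimal distance. -/
def hexInradius : ℝ := (Real.sqrt 2)⁻¹ * (Real.sqrt (2 * Real.sqrt 3))⁻¹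

lemma hexInradius_pos : 0 < hexInradius := by
  unfold hexInradius
  positivity

lemma hexInradius_sq : hexInradius ^ 2 * (4 * √3) = 1 := by
  unfold hexInradius
  rw [mul_pow, inv_pow, inv_pow, Real.sq_sqrt (by norm_num), Real.sq_sqrt (by positivity)]
  field_simp
  norm_num

lemma hexPt_zero (m : Fin 2 → ℤ) : hexPt m 0 = hexInradius * (2 * m 0 + m 1) := by
  simp [hexPt, MA2, hexInradius, Matrix.vecHead, Matrix.vecTail]
  ring

lemma hexPt_one (m : Fin 2 → ℤ) : hexPt m 1 = hexInradius * (√3 * m 1) := by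
  simp [hexPt, MA2, hexInradius, Matrix.vecHead, Matrix.vecTail]
  ring

/-- `x` is no farther from the origin than from `c • v` iff it lies in the half-plane bounded by
the perpendicular bisector. -/
lemma norm_le_norm_sub_smul_iff {E : Type*} [NormedAddCommGroup E] [InnerProductSpace ℝ E]
    {c : ℝ} (hc : 0 < c) (x v : E) :
    ‖x‖ ≤ ‖x - c • v‖ ↔ 2 * inner ℝ x v ≤ c * ‖v‖ ^ 2 := by
  rw [← sq_le_sq₀ (norm_nonneg _) (norm_nonneg _), norm_sub_sq_real, inner_smul_right, norm_smul,
    mul_pow, Real.norm_eq_abs, sq_abs]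
  constructor <;> intro h
  · exact le_of_mul_le_mul_left (by linarith) hc
  · nlinarith [mul_le_mul_of_nonneg_left h hc.le]

lemma vorCell_mono {c d : ℝ} (hc : 0 < c) (hcd : c ≤ d) : vorCell c ⊆ vorCell d := by
  intro x hx m
  have h := (norm_le_norm_sub_smul_iff hc x (hexPt m)).1 (hx m)
  exact (norm_le_norm_sub_smul_iff (hc.trans_le hcd) x (hexPt m)).2
    (h.trans (mul_le_mul_of_nonneg_right hcd (by positivity)))

lemma isClosed_vorCell (c : ℝ) : IsClosed (vorCell c) := by
  simp only [vorCell, Set.ofPred_forall]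
  exact isClosed_iInter fun m => isClosed_le (by fun_prop) (by fun_prop)

lemma measurableSet_vorShell (k : ℕ) : MeasurableSet (vorShell k) := by
  cases k with
  | zero => exact (isClosed_vorCell _).measurableSet
  | succ k => exact (isClosed_vorCell _).measurableSet.diff (isClosed_vorCell _).measurableSet

lemma vorShell_subset (k : ℕ) : vorShell k ⊆ vorCell (2 * k + 1) := by
  cases k with
  | zero => simp [vorShell]
  | succ k => simp [vorShell]

lemma disjoint_vorShell_of_lt {j k : ℕ} (h : j < k) : Disjoint (vorShell j) (vorShell k) := by
  obtain ⟨k, rfl⟩ : ∃ l, k = l + 1 := ⟨k - 1, by omega⟩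
  have hjk : (j : ℝ) ≤ k := by exact_mod_cast Nat.lt_succ_iff.1 h
  refine Set.disjoint_left.2 fun x hj hk => hk.2 ?_
  exact vorCell_mono (by positivity) (by linarith) (vorShell_subset j hj)

lemma pairwise_disjoint_vorShell : Pairwise (Function.onFun Disjoint vorShell) := by
  intro j k hjk
  rcases hjk.lt_or_gt with h | h
  · exact disjoint_vorShell_of_lt h
  · exact (disjoint_vorShell_of_lt h).symm

/-- The disc of radius `c` times the inradius is contained in the Voronoi cell of `c • Λ`. -/
lemma mem_vorCell_of_norm_le {c : ℝ} (hc : 0 < c) {x : EuclideanSpace ℝ (Fin 2)}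
    (hx : ‖x‖ ≤ c * hexInradius) : x ∈ vorCell c := by
  intro m
  rw [norm_le_norm_sub_smul_iff hc]
  have hs := hexInradius_pos
  by_cases hm : m 0 = 0 ∧ m 1 = 0
  · have : hexPt m = 0 := by
      ext i
      fin_cases i
      · simp [hexPt_zero, hm]
      · simp [hexPt_one, hm]
    simp [this]
  have hQ : (1 : ℝ) ≤ m 0 ^ 2 + m 0 * m 1 + m 1 ^ 2 := by
    have : 0 < m 0 ^ 2 + m 0 * m 1 + m 1 ^ 2 := by
      by_contra! h
      have h1 : m 1 = 0 := by nlinarith [sq_nonneg (2 * m 0 + m 1), sq_nonneg (m 1)]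
      have h0 : m 0 = 0 := by
        rw [h1] at h
        nlinarith [sq_nonneg (m 0)]
      exact hm ⟨h0, h1⟩
    exact_mod_cast this
  have hv : 2 * hexInradius ≤ ‖hexPt m‖ := by
    refine le_of_sq_le_sq ?_ (norm_nonneg _)
    rw [EuclideanSpace.norm_sq_eq, Fin.sum_univ_two, hexPt_zero, hexPt_one]
    simp only [Real.norm_eq_abs, sq_abs, mul_pow]
    rw [Real.sq_sqrt (by norm_num)]
    nlinarith [mul_le_mul_of_nonneg_left hQ (sq_nonneg hexInradius)]
  calc 2 * inner ℝ x (hexPt m) ≤ 2 * (‖x‖ * ‖hexPt m‖) := by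
        gcongr
        exact real_inner_le_norm _ _
    _ ≤ 2 * (c * hexInradius * ‖hexPt m‖) := by gcongr
    _ = c * ((2 * hexInradius) * ‖hexPt m‖) := by ring
    _ ≤ c * (‖hexPt m‖ * ‖hexPt m‖) := by gcongr
    _ = c * ‖hexPt m‖ ^ 2 := by ring

/-- The regular hexagon with inradius `s`, in Cartesian coordinates. -/
def hexagon (s : ℝ) : Set (ℝ × ℝ) := {p | |p.1| ≤ s ∧ |p.2| ≤ (2 * s - |p.1|) / √3}

lemma measurableSet_hexagon (s : ℝ) : MeasurableSet (hexagon s) :=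
  MeasurableSet.inter (s₁ := {p : ℝ × ℝ | |p.1| ≤ s})
    (s₂ := {p : ℝ × ℝ | |p.2| ≤ (2 * s - |p.1|) / √3})
    (measurableSet_le (by fun_prop) (by fun_prop)) (measurableSet_le (by fun_prop) (by fun_prop))

lemma intervalIntegral_abs_symm {s : ℝ} (hs : 0 ≤ s) : ∫ x in (-s)..s, |x| = s ^ 2 := by
  have hint : ∀ a b : ℝ, IntervalIntegrable (fun x : ℝ => |x|) volume a b :=
    fun a b => continuous_abs.intervalIntegrable a b
  have hpos : ∫ x in (0 : ℝ)..s, |x| = s ^ 2 / 2 := by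
    rw [intervalIntegral.integral_congr (g := fun x => x), integral_id]
    · ring
    · intro x hx
      rw [Set.uIcc_of_le hs] at hx
      exact abs_of_nonneg hx.1
  have hneg : ∫ x in (-s)..0, |x| = s ^ 2 / 2 := by
    rw [← hpos]
    simpa using (intervalIntegral.integral_comp_neg (a := 0) (b := s) fun x : ℝ => |x|).symm
  rw [← intervalIntegral.integral_add_adjacent_intervals (hint _ 0) (hint 0 _), hneg, hpos]
  ring

lemma volume_hexagon {s : ℝ} (hs : 0 ≤ s) :
    volume (hexagon s) = ENNReal.ofReal (6 * s ^ 2 / √3) := by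
  have hslice : ∀ x : ℝ, volume (Prod.mk x ⁻¹' hexagon s) =
      (Set.Icc (-s) s).indicator
        (fun x => ENNReal.ofReal (2 * ((2 * s - |x|) / √3))) x := by
    intro x
    by_cases hx : |x| ≤ s
    · rw [Set.indicator_of_mem (Set.mem_Icc.2 (abs_le.1 hx))]
      have : Prod.mk x ⁻¹' hexagon s =
          Set.Icc (-((2 * s - |x|) / √3)) ((2 * s - |x|) / √3) := by
        ext y
        rw [Set.mem_Icc, ← abs_le]
        exact and_iff_right hx
      rw [this, Real.volume_Icc]
      ring_nf
    · rw [Set.indicator_of_notMem (fun h => hx (abs_le.2 (Set.mem_Icc.1 h)))]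
      have : Prod.mk x ⁻¹' hexagon s = ∅ := by
        ext y
        simp [hexagon, hx]
      rw [this, measure_empty]
  have hcont : Continuous fun x : ℝ => 2 * ((2 * s - |x|) / √3) := by fun_prop
  rw [Measure.volume_eq_prod, Measure.prod_apply (measurableSet_hexagon s)]
  simp_rw [hslice]
  rw [lintegral_indicator measurableSet_Icc, ← ofReal_integral_eq_lintegral_ofReal
    (hcont.integrableOn_Icc)]
  · congr 1
    rw [integral_Icc_eq_integral_Ioc, ← intervalIntegral.integral_of_le (by linarith),
      intervalIntegral.integral_const_mul, intervalIntegral.integral_div,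
      intervalIntegral.integral_sub (by simp) (continuous_abs.intervalIntegrable _ _),
      intervalIntegral_abs_symm hs, intervalIntegral.integral_const, smul_eq_mul]
    ring
  · refine (ae_restrict_iff' measurableSet_Icc).2 (.of_forall fun x hx => ?_)
    have := abs_le.2 hx
    have : 0 ≤ 2 * s - |x| := by linarith
    simp only [Pi.zero_apply]
    positivity

lemma mem_hexagon_of_mem_vorCell_one {x : EuclideanSpace ℝ (Fin 2)} (hx : x ∈ vorCell 1) :
    (x 0, x 1) ∈ hexagon hexInradius := by
  have hs := hexInradius_pos
  have h3 : √3 ^ 2 = 3 := Real.sq_sqrt (by norm_num)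
  have key : ∀ a b : ℤ, x 0 * (2 * a + b) + x 1 * (√3 * b) ≤
      2 * hexInradius * (a ^ 2 + a * b + b ^ 2) := by
    intro a b
    have h := (norm_le_norm_sub_smul_iff one_pos x (hexPt ![a, b])).1 (hx _)
    rw [EuclideanSpace.norm_sq_eq, PiLp.inner_apply, Fin.sum_univ_two, Fin.sum_univ_two] at h
    simp only [hexPt_zero, hexPt_one, Real.norm_eq_abs, sq_abs, mul_pow, h3] at h
    simp at h
    refine le_of_mul_le_mul_left (a := 2 * hexInradius) ?_ (by positivity)
    linarith
  have h1 := key 1 0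
  have h2 := key (-1) 0
  have h3' := key 0 1
  have h4 := key 0 (-1)
  have h5 := key (-1) 1
  have h6 := key 1 (-1)
  norm_num at h1 h2 h3' h4 h5 h6
  refine ⟨abs_le.2 ⟨by linarith, by linarith⟩, ?_⟩
  rw [le_div_iff₀ (by positivity)]
  rcases abs_cases (x 0) with ⟨h, _⟩ | ⟨h, _⟩ <;> rcases abs_cases (x 1) with ⟨h', _⟩ | ⟨h', _⟩ <;>
    simp only [h, h'] <;> linarith

/-- The Voronoi cell of `Λ` has area at most the covolume `1 / 2`. -/
lemma volume_vorCell_one_le : volume (vorCell 1) ≤ ENNReal.ofReal (1 / 2) := by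
  have hmp := (volume_preserving_finTwoArrow ℝ).comp (PiLp.volume_preserving_ofLp (Fin 2))
  calc volume (vorCell 1)
      ≤ volume (((MeasurableEquiv.finTwoArrow : (Fin 2 → ℝ) ≃ᵐ ℝ × ℝ) ∘ WithLp.ofLp) ⁻¹'
          hexagon hexInradius) :=
        measure_mono fun x hx => mem_hexagon_of_mem_vorCell_one hx
    _ = volume (hexagon hexInradius) :=
        hmp.measure_preimage (measurableSet_hexagon _).nullMeasurableSet
    _ = ENNReal.ofReal (1 / 2) := by
        rw [volume_hexagon hexInradius_pos.le]
        congr 1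
        have h := hexInradius_sq
        have h3 : √3 ^ 2 = 3 := Real.sq_sqrt (by norm_num)
        field_simp
        nlinarith

lemma integrable_gaussian_norm :
    Integrable fun x : EuclideanSpace ℝ (Fin 2) => rexp (-π * ‖x‖ ^ 2) := by
  refine (integrable_of_integral_eq_one ?_)
  rw [GaussianFourier.integral_rexp_neg_mul_sq_norm pi_pos]
  simp [pi_ne_zero]

lemma integral_gaussian_norm :
    ∫ x : EuclideanSpace ℝ (Fin 2), rexp (-π * ‖x‖ ^ 2) = 1 := by
  rw [GaussianFourier.integral_rexp_neg_mul_sq_norm pi_pos]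
  simp [pi_ne_zero]

lemma setIntegral_ball_gaussian {R : ℝ} (hR : 0 ≤ R) :
    ∫ x in Metric.ball (0 : EuclideanSpace ℝ (Fin 2)) R, rexp (-π * ‖x‖ ^ 2) =
      1 - rexp (-π * R ^ 2) := by
  have h := integral_fun_norm_addHaar (volume : Measure (EuclideanSpace ℝ (Fin 2)))
    ((Set.Iio R).indicator fun r => rexp (-π * r ^ 2))
  have hball : (fun x : EuclideanSpace ℝ (Fin 2) =>
      (Set.Iio R).indicator (fun r => rexp (-π * r ^ 2)) ‖x‖) =
      (Metric.ball 0 R).indicator fun x => rexp (-π * ‖x‖ ^ 2) := by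
    ext x
    by_cases hx : ‖x‖ < R
    · rw [Set.indicator_of_mem (Set.mem_Iio.2 hx), Set.indicator_of_mem (mem_ball_zero_iff.2 hx)]
    · rw [Set.indicator_of_notMem (mt Set.mem_Iio.1 hx), Set.indicator_of_notMem (by rwa [mem_ball_zero_iff])]
  have hrad : ∀ y : ℝ, y ^ (2 - 1) • (Set.Iio R).indicator (fun r => rexp (-π * r ^ 2)) y =
      (Set.Iio R).indicator (fun r => r * rexp (-π * r ^ 2)) y := by
    intro y
    simp [Set.indicator_apply]
  rw [hball, integral_indicator Metric.isOpen_ball.measurableSet] at h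
  simp only [finrank_euclideanSpace, Fintype.card_fin, hrad] at h
  rw [h, setIntegral_indicator measurableSet_Iio, Set.Ioi_inter_Iio,
    ← integral_Ioc_eq_integral_Ioo, ← intervalIntegral.integral_of_le hR,
    intervalIntegral.integral_eq_sub_of_hasDerivAt
      (f := fun r => -(2 * π)⁻¹ * rexp (-π * r ^ 2))]
  · simp [Measure.real, EuclideanSpace.volume_ball_fin_two, pi_pos.le]
    field_simp
    ring
  · intro r _
    have := (((hasDerivAt_pow 2 r).const_mul (-π)).exp).const_mul (-(2 * π)⁻¹)
    refine this.congr_deriv ?_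
    push_cast
    field_simp
  · exact Continuous.intervalIntegrable (by fun_prop) _ _

/-- Rearrangement bound: among sets of area at most `A`, the centred disc has the largest Gaussian
mass. -/
lemma setIntegral_gaussian_le {A : ℝ} (hA : 0 ≤ A) {S : Set (EuclideanSpace ℝ (Fin 2))}
    (hS : MeasurableSet S) (hvol : volume S ≤ ENNReal.ofReal A) :
    ∫ x in S, rexp (-π * ‖x‖ ^ 2) ≤ 1 - rexp (-A) := by
  set R := √(A / π) with hR
  have hR2 : π * R ^ 2 = A := by
    rw [hR, Real.sq_sqrt (by positivity)]
    field_simp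
  have hSfin : volume S ≠ ⊤ := ne_top_of_le_ne_top ENNReal.ofReal_ne_top hvol
  have hBfin : volume (Metric.ball (0 : EuclideanSpace ℝ (Fin 2)) R) ≠ ⊤ :=
    measure_ball_lt_top.ne
  have hB : MeasurableSet (Metric.ball (0 : EuclideanSpace ℝ (Fin 2)) R) :=
    Metric.isOpen_ball.measurableSet
  have hpt : ∀ x : EuclideanSpace ℝ (Fin 2),
      S.indicator (fun x => rexp (-π * ‖x‖ ^ 2)) x ≤ S.indicator (fun _ => rexp (-A)) x +
        (Metric.ball 0 R).indicator (fun x => rexp (-π * ‖x‖ ^ 2) - rexp (-A)) x := by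
    intro x
    by_cases hxB : x ∈ Metric.ball (0 : EuclideanSpace ℝ (Fin 2)) R
    · have hxR : ‖x‖ < R := by simpa using hxB
      have hle : rexp (-A) ≤ rexp (-π * ‖x‖ ^ 2) := by
        rw [Real.exp_le_exp, ← hR2, neg_mul, neg_le_neg_iff]
        gcongr
      by_cases hxS : x ∈ S <;> simp only [hxS, hxB, Set.indicator_of_mem, Set.indicator_of_notMem,
        not_false_eq_true] <;> linarith
    · have hxR : R ≤ ‖x‖ := by simpa using hxB
      have hle : rexp (-π * ‖x‖ ^ 2) ≤ rexp (-A) := by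
        rw [Real.exp_le_exp, ← hR2, neg_mul, neg_le_neg_iff]
        gcongr
      by_cases hxS : x ∈ S <;> simp only [hxS, hxB, Set.indicator_of_mem, Set.indicator_of_notMem,
        not_false_eq_true] <;> linarith
  have hI1 : Integrable (S.indicator fun _ : EuclideanSpace ℝ (Fin 2) => rexp (-A)) :=
    (integrable_indicator_iff hS).2 (integrableOn_const hSfin)
  have hcB : IntegrableOn (fun _ : EuclideanSpace ℝ (Fin 2) => rexp (-A)) (Metric.ball 0 R) :=
    integrableOn_const hBfin
  have hI2 : Integrable ((Metric.ball (0 : EuclideanSpace ℝ (Fin 2)) R).indicator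
      fun x => rexp (-π * ‖x‖ ^ 2) - rexp (-A)) :=
    (integrable_indicator_iff hB).2 (integrable_gaussian_norm.integrableOn.sub hcB)
  have h := integral_mono (integrable_gaussian_norm.indicator hS) (hI1.add hI2) hpt
  have hballvol : volume.real (Metric.ball (0 : EuclideanSpace ℝ (Fin 2)) R) = A := by
    rw [Measure.real, EuclideanSpace.volume_ball_fin_two, ENNReal.toReal_mul, ENNReal.toReal_pow,
      ENNReal.toReal_ofReal (Real.sqrt_nonneg _), ENNReal.toReal_ofReal pi_pos.le, mul_comm, hR2]
  have hSvol : volume.real S ≤ A := ENNReal.toReal_le_of_le_ofReal hA hvol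
  simp only [Pi.add_apply] at h
  rw [integral_add hI1 hI2, integral_indicator hS, integral_indicator hS, integral_indicator hB,
    integral_sub integrable_gaussian_norm.integrableOn hcB, setIntegral_const, setIntegral_const,
    setIntegral_ball_gaussian (Real.sqrt_nonneg _), hballvol, neg_mul, hR2, smul_eq_mul,
    smul_eq_mul] at h
  nlinarith [mul_le_mul_of_nonneg_right hSvol (Real.exp_pos (-A)).le]

/-- The even shells other than the central cell carry at most the Gaussian mass outside the disc
inscribed in `V(3Λ)`. -/
lemma pEven_le : pEven ≤ (∫ x in vorCell 1, rexp (-π * ‖x‖ ^ 2)) +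
    rexp (-π * (3 * hexInradius) ^ 2) := by
  have hs := hexInradius_pos
  set B := Metric.ball (0 : EuclideanSpace ℝ (Fin 2)) (3 * hexInradius) with hBdef
  have hB : MeasurableSet B := Metric.isOpen_ball.measurableSet
  have hdisj : Pairwise (Function.onFun Disjoint fun k : ℕ => vorShell (2 * k)) :=
    fun j k hjk => pairwise_disjoint_vorShell (by omega)
  have hsub : (⋃ k : ℕ, vorShell (2 * k)) ⊆ vorCell 1 ∪ Bᶜ := by
    refine Set.iUnion_subset fun k x hx => ?_
    cases k with
    | zero => exact Or.inl hx
    | succ k =>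
      right
      rw [Set.mem_compl_iff, hBdef, mem_ball_zero_iff]
      intro hlt
      have h3 : x ∈ vorCell 3 := mem_vorCell_of_norm_le (by norm_num) hlt.le
      refine hx.2 (vorCell_mono (by norm_num) ?_ h3)
      push_cast
      have : (0 : ℝ) ≤ k := k.cast_nonneg
      linarith
  have hnonneg : ∀ T : Set (EuclideanSpace ℝ (Fin 2)),
      0 ≤ᵐ[volume.restrict T] fun x => rexp (-π * ‖x‖ ^ 2) :=
    fun T => .of_forall fun x => (Real.exp_pos _).le
  have hcell := (isClosed_vorCell 1).measurableSet
  have hcompl : ∫ x in Bᶜ, rexp (-π * ‖x‖ ^ 2) = rexp (-π * (3 * hexInradius) ^ 2) := by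
    have h := integral_add_compl hB integrable_gaussian_norm
    rw [integral_gaussian_norm, setIntegral_ball_gaussian (by positivity)] at h
    linarith
  calc pEven = ∫ x in ⋃ k : ℕ, vorShell (2 * k), rexp (-π * ‖x‖ ^ 2) :=
        (integral_iUnion (fun k => measurableSet_vorShell _) hdisj
          integrable_gaussian_norm.integrableOn).symm
    _ ≤ ∫ x in vorCell 1 ∪ Bᶜ, rexp (-π * ‖x‖ ^ 2) :=
        setIntegral_mono_set integrable_gaussian_norm.integrableOn (hnonneg _) hsub.eventuallyLE
    _ ≤ (∫ x in vorCell 1, rexp (-π * ‖x‖ ^ 2)) + ∫ x in Bᶜ, rexp (-π * ‖x‖ ^ 2) := by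
        rw [← Set.union_sdiff_self, setIntegral_union Set.disjoint_sdiff_right
          (hB.compl.diff hcell) integrable_gaussian_norm.integrableOn
          integrable_gaussian_norm.integrableOn]
        gcongr
        · exact hnonneg _
        · exact integrable_gaussian_norm.integrableOn
        · exact Set.sdiff_subset
    _ = _ := by rw [hcompl]

lemma pEven_le_d2 : pEven ≤ 0.46 := by
  have hcell := setIntegral_gaussian_le (A := 1 / 2) (by norm_num)
    (isClosed_vorCell 1).measurableSet volume_vorCell_one_le
  have hhalf : (0.6 : ℝ) ≤ rexp (-(1 / 2)) := by
    have h2 : rexp (-(1 / 2)) ^ 2 * rexp 1 = 1 := by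
      rw [← Real.exp_nat_mul, ← Real.exp_add]
      norm_num
    by_contra! hlt
    have hp := Real.exp_pos (-(1 / 2))
    nlinarith [Real.exp_one_lt_d9, Real.exp_pos 1]
  have htail : rexp (-π * (3 * hexInradius) ^ 2) ≤ 0.06 := by
    have h3 : √3 ≤ 1.74 := Real.sqrt_le_iff.2 (by norm_num)
    have hs : 1.29 ≤ (3 * hexInradius) ^ 2 := by
      nlinarith [hexInradius_sq, mul_le_mul_of_nonneg_left h3 (sq_nonneg hexInradius)]
    have hexp : rexp (-π * (3 * hexInradius) ^ 2) ≤ rexp (-3) := by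
      rw [Real.exp_le_exp]
      nlinarith [pi_gt_three]
    have h1 : rexp (-3) * rexp 1 ^ 3 = 1 := by
      rw [← Real.exp_nat_mul, ← Real.exp_add]
      norm_num
    have he : (2.7 : ℝ) ^ 3 ≤ rexp 1 ^ 3 :=
      pow_le_pow_left₀ (by norm_num) (by linarith [Real.exp_one_gt_d9]) 3
    have := mul_le_mul_of_nonneg_left he (Real.exp_pos (-3)).le
    refine hexp.trans ?_
    rw [h1] at this
    norm_num1 at this ⊢
    linarith
  linarith [pEven_le]

/-- With `p₀` the Gaussian mass of the even Voronoi shells of the hexagonal GKP code and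
`p₁ = 1 − p₀`, one has `p₀ ≤ 0.46`; in particular `p₀ ≠ 1/2` and
`|p₀ − p₁| = |2p₀ − 1| ≥ 0.08`. -/
theorem hexagonal_gkp_heterodyne_depolarizing_bound :
    pEven ≤ 0.46 ∧ pEven ≠ 1 / 2 ∧
      |pEven - (1 - pEven)| = |2 * pEven - 1| ∧ 0.08 ≤ |2 * pEven - 1| := by
  have h := pEven_le_d2
  norm_num at h
  refine ⟨pEven_le_d2, by linarith, by congr 1; ring, ?_⟩
  rw [abs_of_nonpos (by linarith)]
  norm_num
  linarith

end
end
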